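/- Lenstra's theorem: for all n ≥ 0, the n-th Motzkin set of the Gaussian integers equals the set of (1+i)-ary expansions of length at most n+1: A_{ℤ[i],n} = {Σ_{j=0}^n v_j(1+i)^j : v_j ∈ {0, ±1, ±i}}. Equivalently, φ_{ℤ[i]}^{-1}([0,n]) = B_n. -/

import Mathlib

def MotzkinSet : ℕ → Set GaussianInt
  | 0 => {z | z = 0 ∨ IsUnit z}
  | n + 1 => MotzkinSet n ∪ {β | ∀ x : GaussianInt, ∃ r ∈ MotzkinSet n, β ∣ (x - r)}

def Bset (n : ℕ) : Set GaussianInt :=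
  {z | ∃ v : ℕ → GaussianInt,
    (∀ j, v j ∈ ({0, 1, -1, ⟨0, 1⟩, ⟨0, -1⟩} : Set GaussianInt)) ∧
    z = ∑ j ∈ Finset.range (n + 1), v j * (⟨1, 1⟩ : GaussianInt) ^ j}

noncomputable def phi (z : GaussianInt) : ℕ := sInf {n | z ∈ MotzkinSet n}


def ww : ℕ → ℤ
  | 0 => 3
  | 1 => 4
  | n + 2 => 2 * ww n

theorem ww_two (n : ℕ) : ww (n + 2) = 2 * ww n := by rw [ww]

theorem ww_facts (n : ℕ) : (n : ℤ) + 3 ≤ ww n ∧ ww n + 1 ≤ ww (n + 1) ∧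
    2 * ww (n + 1) ≤ 3 * ww n ∧ 4 * ww n ≤ 3 * ww (n + 1) ∧ ww (n + 1) % 2 = 0 := by
  induction n with
  | zero => simp [ww]
  | succ k ih =>
    have : ww (k + 1 + 1) = 2 * ww k := ww_two k
    push_cast
    refine ⟨?_, ?_, ?_, ?_, ?_⟩ <;> ((try simp only [abs_eq_max_neg] at *); omega)

def Oct (n : ℕ) (x y : ℤ) : Prop :=
  |x| ≤ ww n - 2 ∧ |y| ≤ ww n - 2 ∧ |x| + |y| ≤ ww (n + 1) - 3

def BB : ℕ → ℤ → ℤ → Prop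
  | 0, x, y => |x| + |y| ≤ 1
  | n + 1, x, y => ∃ u v p q : ℤ, |u| + |v| ≤ 1 ∧ BB n p q ∧ x = u + p - q ∧ y = v + p + q

theorem BB_zero_mem (n : ℕ) : BB n 0 0 := by
  induction n with
  | zero => simp [BB]
  | succ k ih => exact ⟨0, 0, 0, 0, by simp, ih, by simp, by simp⟩

theorem BB_mono (n : ℕ) : ∀ x y, BB n x y → BB (n + 1) x y := by
  induction n with
  | zero => intro x y h; exact ⟨x, y, 0, 0, h, by simp [BB], by simp, by simp⟩
  | succ k ih =>
    rintro x y ⟨u, v, p, q, h1, h2, h3, h4⟩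
    exact ⟨u, v, p, q, h1, ih _ _ h2, h3, h4⟩

theorem BB_rot (n : ℕ) : ∀ x y, BB n x y → BB n (-y) x := by
  induction n with
  | zero => intro x y h; simp only [BB, abs_neg] at *; ((try simp only [abs_eq_max_neg] at *); omega)
  | succ k ih =>
    rintro x y ⟨u, v, p, q, h1, h2, h3, h4⟩
    exact ⟨-v, u, -q, p, by rw [abs_neg]; ((try simp only [abs_eq_max_neg] at *); omega), ih _ _ h2, by ((try simp only [abs_eq_max_neg] at *); omega), by ((try simp only [abs_eq_max_neg] at *); omega)⟩

theorem BB_oct (n : ℕ) : ∀ x y, BB n x y → Oct n x y := by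
  induction n with
  | zero => intro x y h; simp only [BB, Oct, ww] at *; ((try simp only [abs_eq_max_neg] at *); omega)
  | succ k ih =>
    rintro x y ⟨u, v, p, q, h1, h2, h3, h4⟩
    have := ih _ _ h2
    have h5 : ww (k + 1 + 1) = 2 * ww k := ww_two k
    simp only [Oct] at *
    ((try simp only [abs_eq_max_neg] at *); omega)

theorem oct_BB (n : ℕ) : ∀ x y, Oct n x y → (x % 2 = 1 ∨ y % 2 = 1) → BB n x y := by
  induction n with
  | zero => intro x y h _; simp only [BB, Oct, ww] at *; ((try simp only [abs_eq_max_neg] at *); omega)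
  | succ k ih =>
    intro x y h hp
    have h5 : ww (k + 1 + 1) = 2 * ww k := ww_two k
    have h6 := ww_facts k
    have h7 := ww_facts (k+1)
    have key : ∃ u v p q : ℤ, |u| + |v| ≤ 1 ∧ (p % 2 = 1 ∨ q % 2 = 1) ∧ Oct k p q ∧
        x = u + p - q ∧ y = v + p + q := by
      have key2 : ∃ u v : ℤ, |u| + |v| ≤ 1 ∧ (x - u) % 2 = 1 ∧ (y - v) % 2 = 1 ∧
          |x - u| ≤ ww (k+1) - 3 ∧ |y - v| ≤ ww (k+1) - 3 ∧
          |x - u| + |y - v| ≤ ww (k+1+1) - 4 := by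
        simp only [Oct] at h
        by_cases hx : x % 2 = 1
        · by_cases hy : y % 2 = 1
          · exact ⟨0, 0, by simp, by ((try simp only [abs_eq_max_neg] at *); omega), by ((try simp only [abs_eq_max_neg] at *); omega), by ((try simp only [abs_eq_max_neg] at *); omega), by ((try simp only [abs_eq_max_neg] at *); omega), by ((try simp only [abs_eq_max_neg] at *); omega)⟩
          · by_cases h0 : 0 ≤ y
            · exact ⟨0, 1, by simp, by ((try simp only [abs_eq_max_neg] at *); omega), by ((try simp only [abs_eq_max_neg] at *); omega), by ((try simp only [abs_eq_max_neg] at *); omega), by ((try simp only [abs_eq_max_neg] at *); omega), by ((try simp only [abs_eq_max_neg] at *); omega)⟩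
            · exact ⟨0, -1, by simp, by ((try simp only [abs_eq_max_neg] at *); omega), by ((try simp only [abs_eq_max_neg] at *); omega), by ((try simp only [abs_eq_max_neg] at *); omega), by ((try simp only [abs_eq_max_neg] at *); omega), by ((try simp only [abs_eq_max_neg] at *); omega)⟩
        · by_cases h0 : 0 ≤ x
          · exact ⟨1, 0, by simp, by ((try simp only [abs_eq_max_neg] at *); omega), by ((try simp only [abs_eq_max_neg] at *); omega), by ((try simp only [abs_eq_max_neg] at *); omega), by ((try simp only [abs_eq_max_neg] at *); omega), by ((try simp only [abs_eq_max_neg] at *); omega)⟩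
          · exact ⟨-1, 0, by simp, by ((try simp only [abs_eq_max_neg] at *); omega), by ((try simp only [abs_eq_max_neg] at *); omega), by ((try simp only [abs_eq_max_neg] at *); omega), by ((try simp only [abs_eq_max_neg] at *); omega), by ((try simp only [abs_eq_max_neg] at *); omega)⟩
      obtain ⟨u, v, h1, h2, h3, h4, h8, h9⟩ := key2
      refine ⟨u, v, ((x - u) + (y - v)) / 2, ((y - v) - (x - u)) / 2, h1, ?_, ?_, ?_, ?_⟩
      · ((try simp only [abs_eq_max_neg] at *); omega)
      · simp only [Oct]; ((try simp only [abs_eq_max_neg] at *); omega)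
      · ((try simp only [abs_eq_max_neg] at *); omega)
      · ((try simp only [abs_eq_max_neg] at *); omega)
    obtain ⟨u, v, p, q, h1, h2, h3, h4⟩ := key
    exact ⟨u, v, p, q, h1, ih _ _ h3 h2, h4⟩

theorem BB_even (n : ℕ) (x y : ℤ) (h : BB (n + 1) (x - y) (x + y)) : BB n x y := by
  obtain ⟨u, v, p, q, h1, h2, h3, h4⟩ := h
  have hp : p = x := by ((try simp only [abs_eq_max_neg] at *); omega)
  have hq : q = y := by ((try simp only [abs_eq_max_neg] at *); omega)
  subst hp hq; exact h2

theorem BB_even' (n : ℕ) (x y : ℤ) (h : BB n x y) : BB (n + 1) (x - y) (x + y) :=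
  ⟨0, 0, x, y, by simp, h, by ring, by ring⟩

theorem BB_double (n : ℕ) (x y : ℤ) : BB (n + 2) (2 * x) (2 * y) ↔ BB n x y := by
  constructor
  · intro h
    have h1 : BB (n + 1) (x + y) (y - x) := by
      apply BB_even; convert h using 1 <;> ring
    have h2 : BB n y (-x) := by
      apply BB_even; convert h1 using 1 <;> ring
    have := BB_rot _ _ _ h2
    simpa using this
  · intro h
    have h1 := BB_rot _ _ _ (BB_rot _ _ _ (BB_rot _ _ _ h))
    have h2 := BB_even' _ _ _ (BB_even' _ _ _ h1)
    convert h2 using 1 <;> ring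

theorem BB_one_even (x y : ℤ) (h : BB 1 (2 * x) (2 * y)) : x = 0 ∧ y = 0 := by
  obtain ⟨u, v, p, q, h1, h2, h3, h4⟩ := h
  simp only [BB] at h2
  ((try simp only [abs_eq_max_neg] at *); omega)

theorem two_step {P : ℕ → Prop} (h0 : P 0) (h1 : P 1) (h2 : ∀ n, P n → P (n + 2)) (n : ℕ) :
    P n := by
  have : P n ∧ P (n + 1) := by
    induction n with
    | zero => exact ⟨h0, h1⟩
    | succ k ih => exact ⟨ih.2, h2 _ ih.1⟩
  exact this.1

theorem BB_exists (x y : ℤ) : ∃ n, BB n x y := by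
  have : ∀ N : ℕ, ∀ x y : ℤ, |x| + |y| ≤ N → ∃ n, BB n x y := by
    intro N
    induction N with
    | zero =>
      intro x y h
      exact ⟨0, by simp only [BB]; ((try simp only [abs_eq_max_neg] at *); omega)⟩
    | succ N ih =>
      intro x y h
      by_cases hp : x % 2 = 1 ∨ y % 2 = 1
      · refine ⟨N + 1, oct_BB _ _ _ ?_ hp⟩
        have h1 := ww_facts (N + 1)
        have h2 := ww_facts (N + 1 + 1)
        simp only [Oct]
        push_cast at *
        ((try simp only [abs_eq_max_neg] at *); omega)
      · by_cases h0 : x = 0 ∧ y = 0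
        · exact ⟨0, by simp [BB, h0]⟩
        obtain ⟨n, hn⟩ := ih (x / 2) (y / 2) (by push_cast at h; ((try simp only [abs_eq_max_neg] at *); omega))
        refine ⟨n + 2, ?_⟩
        have := (BB_double _ _ _).2 hn
        convert this using 1 <;> ((try simp only [abs_eq_max_neg] at *); omega)
  exact this (|x| + |y|).toNat x y (by ((try simp only [abs_eq_max_neg] at *); omega))

/-- description of elements of the octagon which are not in `BB`. -/
theorem lemA (n : ℕ) : ∀ x y, ¬ BB n x y → Oct n x y → ∃ J : ℤ, 2 ≤ J ∧ 2 ∣ J ∧ J ∣ x ∧ J ∣ y ∧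
    J ∣ ww n ∧ J ∣ ww (n + 1) ∧
    (ww n - J ≤ |x| ∨ ww n - J ≤ |y| ∨ ww (n + 1) - 2 * J ≤ |x| + |y|) := by
  induction n using two_step with
  | h0 => intro x y h h'; exfalso; apply h; simp only [BB, Oct, ww] at *; ((try simp only [abs_eq_max_neg] at *); omega)
  | h1 =>
    intro x y h h'
    have hp : ¬ (x % 2 = 1 ∨ y % 2 = 1) := fun hp => h (oct_BB _ _ _ h' hp)
    have h0 : ¬ (x = 0 ∧ y = 0) := by
      rintro ⟨rfl, rfl⟩; exact h (BB_zero_mem _)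
    refine ⟨2, le_rfl, dvd_rfl, by ((try simp only [abs_eq_max_neg] at *); omega), by ((try simp only [abs_eq_max_neg] at *); omega), by simp [ww], by simp [ww], ?_⟩
    simp only [ww, Oct] at *
    ((try simp only [abs_eq_max_neg] at *); omega)
  | h2 n ih =>
    intro x y h h'
    have hp : ¬ (x % 2 = 1 ∨ y % 2 = 1) := fun hp => h (oct_BB _ _ _ h' hp)
    obtain ⟨x, rfl⟩ : ∃ k, x = 2 * k := ⟨x / 2, by ((try simp only [abs_eq_max_neg] at *); omega)⟩
    obtain ⟨y, rfl⟩ : ∃ k, y = 2 * k := ⟨y / 2, by ((try simp only [abs_eq_max_neg] at *); omega)⟩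
    rw [BB_double] at h
    have e1 : ww (n + 1 + 1) = 2 * ww n := ww_two n
    have e2 := ww_two (n + 1)
    rw [show n + 1 + 2 = n + 2 + 1 by ring] at e2
    rw [e1, e2]
    by_cases ho : Oct n x y
    · obtain ⟨J, h1, _, h2, h3, h4, h5, h6⟩ := ih _ _ h ho
      refine ⟨2 * J, by ((try simp only [abs_eq_max_neg] at *); omega), by simp, mul_dvd_mul_left _ h2, mul_dvd_mul_left _ h3,
        mul_dvd_mul_left _ h4, mul_dvd_mul_left _ h5, ?_⟩
      ((try simp only [abs_eq_max_neg] at *); omega)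
    · refine ⟨2, le_rfl, dvd_rfl, by simp, by simp, by simp, by simp, ?_⟩
      simp only [Oct] at ho
      ((try simp only [abs_eq_max_neg] at *); omega)

theorem lemB0 (W W' J p q a b : ℤ) (hW : W + 1 ≤ W') (hW2 : 2 * W' ≤ 3 * W) (hW3 : 3 ≤ W)
    (he : W' % 2 = 0)
    (hJ : 2 ≤ J) (hJ2 : 2 ∣ J) (hp : J ∣ p) (hq : J ∣ q) (hJW : J ∣ W) (hJW' : J ∣ W')
    (hf : W - J ≤ p ∨ W' - 2 * J ≤ p + q) (h0 : 0 ≤ q) (hpq : q ≤ p)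
    (hab : |b| < a) (hodd : (a + b) % 2 = 1) (ha : a ≤ W' - 2) (hs : a + |b| ≤ 2 * W - 3)
    (hx : p + q ≤ a - 1) (hx2 : p ≤ W - 2) :
    (|p - a| ≤ W - 2 ∧ |q - b| ≤ W - 2 ∧ |p - a| + |q - b| ≤ W' - 3) ∨
    (|p + b| ≤ W - 2 ∧ |q - a| ≤ W - 2 ∧ |p + b| + |q - a| ≤ W' - 3) := by
  have f1 : J ≤ 2 * W - W' := Int.le_of_dvd (by ((try simp only [abs_eq_max_neg] at *); omega)) (dvd_sub (hJW.mul_left 2) hJW')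
  have f2 : J ≤ W' - W := Int.le_of_dvd (by ((try simp only [abs_eq_max_neg] at *); omega)) (dvd_sub hJW' hJW)
  have f3 : p < W' - W → J ≤ W' - W - p := fun h =>
    Int.le_of_dvd (by ((try simp only [abs_eq_max_neg] at *); omega)) (dvd_sub (dvd_sub hJW' hJW) hp)
  have f4 : q < W' - W → J ≤ W' - W - q := fun h =>
    Int.le_of_dvd (by ((try simp only [abs_eq_max_neg] at *); omega)) (dvd_sub (dvd_sub hJW' hJW) hq)
  have f5 : p + q < 2 * W - W' → J ≤ 2 * W - W' - (p + q) := fun h =>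
    Int.le_of_dvd (by ((try simp only [abs_eq_max_neg] at *); omega)) (dvd_sub (dvd_sub (hJW.mul_left 2) hJW') (dvd_add hp hq))
  have g1 : W' - W ≤ p := by ((try simp only [abs_eq_max_neg] at *); omega)
  have g2 : 2 * W - W' ≤ p + q := by ((try simp only [abs_eq_max_neg] at *); omega)
  rcases le_or_gt 0 b with hb | hb
  · left
    rw [abs_of_nonneg hb] at *
    refine ⟨by ((try simp only [abs_eq_max_neg] at *); omega), by ((try simp only [abs_eq_max_neg] at *); omega), ?_⟩
    rw [abs_of_nonpos (show p - a ≤ 0 by ((try simp only [abs_eq_max_neg] at *); omega))]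
    rcases le_or_gt q b with hqb | hqb
    · rw [abs_of_nonpos (show q - b ≤ 0 by ((try simp only [abs_eq_max_neg] at *); omega))]; ((try simp only [abs_eq_max_neg] at *); omega)
    · rw [abs_of_pos (show 0 < q - b by ((try simp only [abs_eq_max_neg] at *); omega))]
      by_contra hlt
      have k1 : a = W' - 2 := by ((try simp only [abs_eq_max_neg] at *); omega)
      have k2 : b = 0 := by ((try simp only [abs_eq_max_neg] at *); omega)
      ((try simp only [abs_eq_max_neg] at *); omega)
  · rw [abs_of_neg hb] at *
    by_cases hc : a - p + q - b ≤ W' - 3 ∧ q - b ≤ W - 2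
    · left
      refine ⟨by ((try simp only [abs_eq_max_neg] at *); omega), by ((try simp only [abs_eq_max_neg] at *); omega), by ((try simp only [abs_eq_max_neg] at *); omega)⟩
    · right
      have g3 : a - q ≤ W - 2 := by
        by_contra hlt
        have := f4 (by ((try simp only [abs_eq_max_neg] at *); omega))
        ((try simp only [abs_eq_max_neg] at *); omega)
      have p2 : 2 ∣ p := hJ2.trans hp
      have q2 : 2 ∣ q := hJ2.trans hq
      refine ⟨by ((try simp only [abs_eq_max_neg] at *); omega), by ((try simp only [abs_eq_max_neg] at *); omega), ?_⟩
      rw [abs_of_nonpos (show q - a ≤ 0 by ((try simp only [abs_eq_max_neg] at *); omega))]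
      rcases le_or_gt (p + b) 0 with hqb | hqb
      · rw [abs_of_nonpos hqb]; ((try simp only [abs_eq_max_neg] at *); omega)
      · rw [abs_of_pos hqb]
        by_contra hlt
        have k0 : q - b ≤ W - 2 := by ((try simp only [abs_eq_max_neg] at *); omega)
        have k1 : a = W' - 2 := by ((try simp only [abs_eq_max_neg] at *); omega)
        have k2 : p - q = -b := by ((try simp only [abs_eq_max_neg] at *); omega)
        ((try simp only [abs_eq_max_neg] at *); omega)

theorem lemB (n : ℕ) (J x y a b : ℤ)
    (hJ : 2 ≤ J) (hJ2 : 2 ∣ J) (hp : J ∣ x) (hq : J ∣ y) (hJW : J ∣ ww n) (hJW' : J ∣ ww (n + 1))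
    (hf : ww n - J ≤ |x| ∨ ww n - J ≤ |y| ∨ ww (n + 1) - 2 * J ≤ |x| + |y|)
    (hab : |b| < a) (hodd : (a + b) % 2 = 1) (ho : Oct (n + 1) a b)
    (hx : |x| + |y| ≤ a - 1) (hx2 : |x| ≤ ww n - 2) (hy2 : |y| ≤ ww n - 2) :
    ∃ u v : ℤ, |u| + |v| = 1 ∧ Oct n (x - (u * a - v * b)) (y - (u * b + v * a)) := by
  have h6 := ww_facts n
  have e1 : ww (n + 1 + 1) = 2 * ww n := ww_two n
  have hp' : J ∣ |x| := (dvd_abs _ _).2 hp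
  have hq' : J ∣ |y| := (dvd_abs _ _).2 hq
  simp only [Oct] at *
  have main : ∀ p q b' : ℤ, J ∣ p → J ∣ q → |b'| = |b| →
      (ww n - J ≤ p ∨ ww (n + 1) - 2 * J ≤ p + q) → 0 ≤ q → q ≤ p → p + q ≤ a - 1 →
      p ≤ ww n - 2 → 
      (|p - a| ≤ ww n - 2 ∧ |q - b'| ≤ ww n - 2 ∧ |p - a| + |q - b'| ≤ ww (n + 1) - 3) ∨
      (|p + b'| ≤ ww n - 2 ∧ |q - a| ≤ ww n - 2 ∧ |p + b'| + |q - a| ≤ ww (n + 1) - 3) := by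
    intro p q b' h1 h2 h3 h4 h5 h7 h8 h9
    exact lemB0 _ _ J p q a b' (by ((try simp only [abs_eq_max_neg] at *); omega)) (by ((try simp only [abs_eq_max_neg] at *); omega)) (by ((try simp only [abs_eq_max_neg] at *); omega)) (by ((try simp only [abs_eq_max_neg] at *); omega)) hJ hJ2 h1 h2 hJW hJW' h4
      h5 h7 (by ((try simp only [abs_eq_max_neg] at *); omega)) (by ((try simp only [abs_eq_max_neg] at *); omega)) (by ((try simp only [abs_eq_max_neg] at *); omega)) (by ((try simp only [abs_eq_max_neg] at *); omega)) h8 h9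
  have u1 : |(1 : ℤ)| + |(0 : ℤ)| = 1 := by simp
  have u2 : |(-1 : ℤ)| + |(0 : ℤ)| = 1 := by simp
  have u3 : |(0 : ℤ)| + |(1 : ℤ)| = 1 := by simp
  have u4 : |(0 : ℤ)| + |(-1 : ℤ)| = 1 := by simp
  have fin : ∀ P : ℤ → ℤ → Prop, (P 1 0 ∨ P (-1) 0 ∨ P 0 1 ∨ P 0 (-1)) →
      ∃ u v : ℤ, |u| + |v| = 1 ∧ P u v := by
    rintro P (h | h | h | h)
    exacts [⟨_, _, u1, h⟩, ⟨_, _, u2, h⟩, ⟨_, _, u3, h⟩, ⟨_, _, u4, h⟩]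
  have oc : ∀ s t s' t' : ℤ,
      (|s| ≤ ww n - 2 ∧ |t| ≤ ww n - 2 ∧ |s| + |t| ≤ ww (n + 1) - 3) →
      ((s' = s ∨ s' = -s) ∧ (t' = t ∨ t' = -t) ∨ (s' = t ∨ s' = -t) ∧ (t' = s ∨ t' = -s)) →
      (|s'| ≤ ww n - 2 ∧ |t'| ≤ ww n - 2 ∧ |s'| + |t'| ≤ ww (n + 1) - 3) := by
    rintro s t s' t' ⟨h1, h2, h3⟩ h
    have : (|s'| = |s| ∧ |t'| = |t|) ∨ (|s'| = |t| ∧ |t'| = |s|) := by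
      simpa only [abs_eq_abs] using h
    rcases this with ⟨e, e'⟩ | ⟨e, e'⟩ <;> rw [e, e']
    · exact ⟨h1, h2, h3⟩
    · exact ⟨h2, h1, by rw [add_comm]; exact h3⟩
  apply fin
  obtain ⟨p, q, b', h1, h2, h3, h4, h5, h6', h7, h8⟩ : ∃ p q b' : ℤ, J ∣ p ∧ J ∣ q ∧ 
      |b'| = |b| ∧ (ww n - J ≤ p ∨ ww (n + 1) - 2 * J ≤ p + q) ∧ 0 ≤ q ∧ q ≤ p ∧
      (p + q ≤ a - 1 ∧ p ≤ ww n - 2) ∧ 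
      (b' = b ∧ (p = x ∧ q = y ∨ p = -x ∧ q = -y ∨ p = y ∧ q = -x ∨ p = -y ∧ q = x) ∨
       b' = -b ∧ (p = x ∧ q = -y ∨ p = -x ∧ q = y ∨ p = y ∧ q = x ∨ p = -y ∧ q = -x)) := by
    clear main fin oc
    have dn : ∀ z : ℤ, J ∣ z → J ∣ -z := fun z h => (dvd_neg).2 h
    rcases le_total |y| |x| with hxy | hxy <;> rcases le_total 0 x with sx | sx <;>
      rcases le_total 0 y with sy | sy
    · have ax := abs_of_nonneg sx
      have ay := abs_of_nonneg sy
      exact ⟨x, y, b, hp, hq, rfl, by omega, by omega, by omega, by omega, by omega⟩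
    · have ax := abs_of_nonneg sx
      have ay := abs_of_nonpos sy
      exact ⟨x, -y, -b, hp, dn _ hq, abs_neg b, by omega, by omega, by omega, by omega, by omega⟩
    · have ax := abs_of_nonpos sx
      have ay := abs_of_nonneg sy
      exact ⟨-x, y, -b, dn _ hp, hq, abs_neg b, by omega, by omega, by omega, by omega, by omega⟩
    · have ax := abs_of_nonpos sx
      have ay := abs_of_nonpos sy
      exact ⟨-x, -y, b, dn _ hp, dn _ hq, rfl, by omega, by omega, by omega, by omega, by omega⟩
    · have ax := abs_of_nonneg sx
      have ay := abs_of_nonneg sy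
      exact ⟨y, x, -b, hq, hp, abs_neg b, by omega, by omega, by omega, by omega, by omega⟩
    · have ax := abs_of_nonneg sx
      have ay := abs_of_nonpos sy
      exact ⟨-y, x, b, dn _ hq, hp, rfl, by omega, by omega, by omega, by omega, by omega⟩
    · have ax := abs_of_nonpos sx
      have ay := abs_of_nonneg sy
      exact ⟨y, -x, b, hq, dn _ hp, rfl, by omega, by omega, by omega, by omega, by omega⟩
    · have ax := abs_of_nonpos sx
      have ay := abs_of_nonpos sy
      exact ⟨-y, -x, -b, dn _ hq, dn _ hp, abs_neg b, by omega, by omega, by omega, by omega,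
        by omega⟩
  have A := main p q b' h1 h2 h3 h4 h5 h6' h7.1 h7.2
  clear main fin hp' hq' hf hab hodd ho hx hx2 hy2 h6 e1 h3 h4 h5 h6' h7
  rcases h8 with ⟨rfl, h8⟩ | ⟨rfl, h8⟩ <;> rcases h8 with ⟨e1, e2⟩ | ⟨e1, e2⟩ | ⟨e1, e2⟩ | ⟨e1, e2⟩ <;>
    rcases A with A | A <;>
    first
    | exact Or.inl (oc _ _ _ _ A (by clear A oc; omega))
    | exact Or.inr (Or.inl (oc _ _ _ _ A (by clear A oc; omega)))
    | exact Or.inr (Or.inr (Or.inl (oc _ _ _ _ A (by clear A oc; omega))))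
    | exact Or.inr (Or.inr (Or.inr (oc _ _ _ _ A (by clear A oc; omega))))

theorem sq_aux (a b N m S T X : ℤ) (hN : N = 2 * m + 1) (hm : 0 ≤ m) (hS : |S| ≤ m)
    (hT : |T| ≤ m) (hX : N * X = a * S + b * T) (hab : 0 < |a| + |b|) : 2 * |X| < |a| + |b| := by
  have h1 : |N * X| ≤ (|a| + |b|) * m := by
    rw [hX]
    calc |a * S + b * T| ≤ |a * S| + |b * T| := abs_add_le _ _
      _ = |a| * |S| + |b| * |T| := by rw [abs_mul, abs_mul]
      _ ≤ |a| * m + |b| * m := by gcongr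
      _ = _ := by ring
  rw [abs_mul, abs_of_pos (show 0 < N by ((try simp only [abs_eq_max_neg] at *); omega))] at h1
  by_contra hlt
  push Not at hlt
  nlinarith

theorem lemSq (a b x y : ℤ) (hab : |b| < a) (hodd : (a + b) % 2 = 1) :
    ∃ c d : ℤ, |x - (c * a - d * b)| + |y - (c * b + d * a)| ≤ a - 1 ∧
      2 * |x - (c * a - d * b)| < a + |b| ∧ 2 * |y - (c * b + d * a)| < a + |b| := by
  have ha : 0 < a := lt_of_le_of_lt (abs_nonneg b) hab
  obtain ⟨m, hm⟩ : ∃ m, a * a + b * b = 2 * m + 1 := by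
    rcases Int.even_or_odd' a with ⟨k, rfl | rfl⟩ <;> rcases Int.even_or_odd' b with ⟨l, rfl | rfl⟩
    · ((try simp only [abs_eq_max_neg] at *); omega)
    · exact ⟨2 * k * k + 2 * l * l + 2 * l, by ring⟩
    · exact ⟨2 * k * k + 2 * k + 2 * l * l, by ring⟩
    · ((try simp only [abs_eq_max_neg] at *); omega)
  have hm0 : 0 ≤ m := by nlinarith [mul_self_nonneg b, mul_pos ha ha]
  have red : ∀ S : ℤ, ∃ c, |S - c * (a * a + b * b)| ≤ m := by
    intro S
    refine ⟨(S + m) / (2 * m + 1), ?_⟩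
    rw [hm]
    have h1 := Int.emod_add_mul_ediv (S + m) (2 * m + 1)
    have h2 := Int.emod_nonneg (S + m) (show 2 * m + 1 ≠ 0 by ((try simp only [abs_eq_max_neg] at *); omega))
    have h3 := Int.emod_lt_of_pos (S + m) (show 0 < 2 * m + 1 by ((try simp only [abs_eq_max_neg] at *); omega))
    rw [abs_le]
    constructor <;> linarith
  obtain ⟨c, hc⟩ := red (x * a + y * b)
  obtain ⟨d, hd⟩ := red (y * a - x * b)
  refine ⟨c, d, ?_⟩
  set X := x - (c * a - d * b) with hX
  set Y := y - (c * b + d * a) with hY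
  have A : |X * a + Y * b| ≤ m := by
    convert hc using 2; rw [hX, hY]; ring
  have B : |Y * a - X * b| ≤ m := by
    convert hd using 2; rw [hX, hY]; ring
  have k1 := sq_aux a (-b) _ m _ _ X hm hm0 A B (by ring) (by rw [abs_neg, abs_of_pos ha]; linarith [abs_nonneg b])
  have k2 := sq_aux b a _ m _ _ Y hm hm0 A B (by ring) (by rw [abs_of_pos ha]; linarith [abs_nonneg b])
  have hb := abs_lt.1 hab
  have k3 := sq_aux (a + b) (a - b) _ m _ _ (X + Y) hm hm0 A B (by ring)
    (by rw [abs_of_pos (show 0 < a + b by linarith), abs_of_pos (show 0 < a - b by linarith)]; linarith)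
  have k4 := sq_aux (a - b) (-(a + b)) _ m _ _ (X - Y) hm hm0 A B (by ring)
    (by rw [abs_neg, abs_of_pos (show 0 < a + b by linarith), abs_of_pos (show 0 < a - b by linarith)]; linarith)
  rw [abs_neg] at k1 k4
  rw [abs_of_pos (show 0 < a + b by linarith), abs_of_pos (show 0 < a - b by linarith)] at k3 k4
  rw [abs_of_pos ha] at k1 k2
  refine ⟨?_, k1, by linarith⟩
  clear k1 k2 A B hX hY hc hd red hb hm
  clear_value X Y
  ((try simp only [abs_eq_max_neg] at *); omega)

theorem lemC0 (n : ℕ) (a b : ℤ) (hab : |b| < a) (hodd : (a + b) % 2 = 1) (ho : Oct (n + 1) a b)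
    (x y : ℤ) : ∃ c d : ℤ, BB n (x - (c * a - d * b)) (y - (c * b + d * a)) := by
  obtain ⟨c, d, h1, h2, h3⟩ := lemSq a b x y hab hodd
  by_cases hB : BB n (x - (c * a - d * b)) (y - (c * b + d * a))
  · exact ⟨c, d, hB⟩
  have h6 := ww_facts n
  have e1 : ww (n + 1 + 1) = 2 * ww n := ww_two n
  have ho' := ho
  obtain ⟨o1, o2, o3⟩ := ho
  have ha : |a| = a := abs_of_pos (lt_of_le_of_lt (abs_nonneg b) hab)
  have hO : Oct n (x - (c * a - d * b)) (y - (c * b + d * a)) := by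
    refine ⟨?_, ?_, ?_⟩ <;> omega
  obtain ⟨J, j1, j2, j3, j4, j5, j6, j7⟩ := lemA n _ _ hB hO
  obtain ⟨u, v, huv, hu⟩ := lemB n J _ _ a b j1 j2 j3 j4 j5 j6 j7 hab hodd ho' h1 hO.1 hO.2.1
  refine ⟨c + u, d + v, ?_⟩
  have := oct_BB n _ _ hu ?_
  · convert this using 1 <;> ring
  · have p1 := j2.trans j3
    have p2 := j2.trans j4
    have : (u = 1 ∧ v = 0) ∨ (u = -1 ∧ v = 0) ∨ (u = 0 ∧ v = 1) ∨ (u = 0 ∧ v = -1) := by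
      clear * - huv
      ((try simp only [abs_eq_max_neg] at *); omega)
    generalize x - (c * a - d * b) = X at *
    generalize y - (c * b + d * a) = Y at *
    clear * - p1 p2 this hodd
    rcases this with ⟨rfl, rfl⟩ | ⟨rfl, rfl⟩ | ⟨rfl, rfl⟩ | ⟨rfl, rfl⟩ <;> omega

theorem lemC (n : ℕ) (a b : ℤ) (hodd : (a + b) % 2 = 1) (ho : Oct (n + 1) a b)
    (x y : ℤ) : ∃ c d : ℤ, BB n (x - (c * a - d * b)) (y - (c * b + d * a)) := by
  have hc : |b| < a ∨ |-b| < -a ∨ |-a| < b ∨ |a| < -b := by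
    clear * - hodd
    ((try simp only [abs_eq_max_neg] at *); omega)
  obtain ⟨o1, o2, o3⟩ := ho
  rcases hc with h | h | h | h
  · exact lemC0 n a b h hodd ⟨o1, o2, o3⟩ x y
  · obtain ⟨c, d, hh⟩ := lemC0 n (-a) (-b) h (by omega)
      ⟨by rwa [abs_neg], by rwa [abs_neg], by rwa [abs_neg, abs_neg]⟩ x y
    refine ⟨-c, -d, ?_⟩
    convert hh using 1 <;> ring
  · obtain ⟨c, d, hh⟩ := lemC0 n b (-a) h (by omega)
      ⟨o2, by rwa [abs_neg], by rwa [abs_neg, add_comm]⟩ x y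
    refine ⟨d, -c, ?_⟩
    convert hh using 1 <;> ring
  · obtain ⟨c, d, hh⟩ := lemC0 n (-b) a h (by omega)
      ⟨by rwa [abs_neg], o1, by rwa [abs_neg, add_comm]⟩ x y
    refine ⟨-d, c, ?_⟩
    convert hh using 1 <;> ring

theorem lemD (n : ℕ) : ∀ a b : ℤ, BB (n + 1) a b → ¬ (a = 0 ∧ b = 0) → ∀ x y : ℤ,
    ∃ c d : ℤ, BB n (x - (c * a - d * b)) (y - (c * b + d * a)) := by
  induction n with
  | zero =>
    intro a b h h0 x y
    by_cases hodd : (a + b) % 2 = 1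
    · exact lemC 0 a b hodd (BB_oct _ _ _ h) x y
    obtain ⟨p, rfl⟩ : ∃ p, a = p - (b - p) := ⟨(a + b) / 2, by omega⟩
    obtain ⟨q, rfl⟩ : ∃ q, b = p + q := ⟨b - p, by ring⟩
    rw [show p + q - p = q by ring] at *
    have h2 : |p| + |q| ≤ 1 := BB_even 0 p q h
    have h3 : (p = 1 ∧ q = 0) ∨ (p = -1 ∧ q = 0) ∨ (p = 0 ∧ q = 1) ∨ (p = 0 ∧ q = -1) := by
      clear * - h2 h0
      ((try simp only [abs_eq_max_neg] at *); omega)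
    simp only [BB]
    have h4 : (x + y) % 2 = 0 ∨ (x + y) % 2 = 1 := by omega
    have h5 : ∃ e s t : ℤ, (e = 0 ∨ e = 1) ∧ x = e + (s - t) ∧ y = s + t := by
      rcases h4 with h4 | h4
      · exact ⟨0, (x + y) / 2, (y - x) / 2, by omega, by omega, by omega⟩
      · exact ⟨1, (x - 1 + y) / 2, (y - x + 1) / 2, by omega, by omega, by omega⟩
    obtain ⟨e, s, t, he, rfl, rfl⟩ := h5
    refine ⟨s * p + t * q, t * p - s * q, ?_⟩
    rcases h3 with ⟨rfl, rfl⟩ | ⟨rfl, rfl⟩ | ⟨rfl, rfl⟩ | ⟨rfl, rfl⟩ <;>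
      rcases he with rfl | rfl <;> ring_nf <;> simp
  | succ n ih =>
    intro a b h h0 x y
    by_cases hodd : (a + b) % 2 = 1
    · exact lemC _ a b hodd (BB_oct _ _ _ h) x y
    obtain ⟨p, rfl⟩ : ∃ p, a = p - (b - p) := ⟨(a + b) / 2, by omega⟩
    obtain ⟨q, rfl⟩ : ∃ q, b = p + q := ⟨b - p, by ring⟩
    rw [show p + q - p = q by ring] at *
    have h2 := BB_even _ p q h
    have h4 : (x + y) % 2 = 0 ∨ (x + y) % 2 = 1 := by omega
    have h5 : ∃ e s t : ℤ, |e| + |(0 : ℤ)| ≤ 1 ∧ x = e + (s - t) ∧ y = s + t := by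
      rcases h4 with h4 | h4
      · exact ⟨0, (x + y) / 2, (y - x) / 2, by simp, by omega, by omega⟩
      · exact ⟨1, (x - 1 + y) / 2, (y - x + 1) / 2, by simp, by omega, by omega⟩
    obtain ⟨e, s, t, he, rfl, rfl⟩ := h5
    obtain ⟨c, d, hh⟩ := ih p q h2 (by omega) s t
    exact ⟨c, d, e, 0, _, _, he, hh, by ring, by ring⟩

theorem octdiv (n : ℕ) (e f a b : ℤ) (hodd : (e + f) % 2 = 1)
    (h : Oct n (e * a - f * b) (e * b + f * a)) : Oct n a b := by
  by_cases h1 : (e = 1 ∧ f = 0) ∨ (e = -1 ∧ f = 0) ∨ (e = 0 ∧ f = 1) ∨ (e = 0 ∧ f = -1)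
  · rcases h1 with ⟨rfl, rfl⟩ | ⟨rfl, rfl⟩ | ⟨rfl, rfl⟩ | ⟨rfl, rfl⟩ <;>
      simp [Oct] at h ⊢ <;> omega
  have h5 : 5 ≤ e * e + f * f := by
    by_contra hlt
    have e1 : e ≤ 2 := by nlinarith [mul_self_nonneg f]
    have e2 : -2 ≤ e := by nlinarith [mul_self_nonneg f]
    have f1 : f ≤ 2 := by nlinarith [mul_self_nonneg e]
    have f2 : -2 ≤ f := by nlinarith [mul_self_nonneg e]
    interval_cases e <;> interval_cases f <;> omega
  obtain ⟨o1, o2, o3⟩ := h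
  have h6 := ww_facts n
  have key : (e * e + f * f) * (a * a + b * b) =
      |e * a - f * b| * |e * a - f * b| + |e * b + f * a| * |e * b + f * a| := by
    rw [abs_mul_abs_self, abs_mul_abs_self]; ring
  have gen : ∀ X Y M : ℤ, 0 ≤ Y → Y ≤ X → X ≤ M → 2 * (X + Y) ≤ 3 * M →
      4 * (X * X + Y * Y) ≤ 5 * (M * M) := by
    intro X Y M h1 h2 h3 h4
    nlinarith [mul_nonneg (sub_nonneg.2 h3) (sub_nonneg.2 h2), mul_nonneg h1 (sub_nonneg.2 h4),
      mul_nonneg (show 0 ≤ M by linarith) (sub_nonneg.2 h4),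
      mul_nonneg (show 0 ≤ M by linarith) (sub_nonneg.2 h3)]
  have gen2 : 4 * (|e * a - f * b| * |e * a - f * b| + |e * b + f * a| * |e * b + f * a|) ≤
      5 * ((ww n - 2) * (ww n - 2)) := by
    rcases le_total |e * a - f * b| |e * b + f * a| with hl | hl
    · rw [add_comm]
      exact gen _ _ _ (abs_nonneg _) hl o2 (by linarith)
    · exact gen _ _ _ (abs_nonneg _) hl o1 (by linarith)
  rw [← key] at gen2
  have gen3 : 4 * (a * a + b * b) ≤ (ww n - 2) * (ww n - 2) := by
    nlinarith [mul_self_nonneg a, mul_self_nonneg b]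
  have ga : |2 * a| ≤ ww n - 2 := abs_le_of_sq_le_sq (by nlinarith [mul_self_nonneg b]) (by linarith [h6.1, Int.natCast_nonneg n])
  have gb : |2 * b| ≤ ww n - 2 := abs_le_of_sq_le_sq (by nlinarith [mul_self_nonneg a]) (by linarith [h6.1, Int.natCast_nonneg n])
  rw [abs_mul, abs_two] at ga gb
  have := abs_nonneg a
  have := abs_nonneg b
  refine ⟨by linarith, by linarith, by linarith⟩

theorem mul_ne (e f a b : ℤ) (hodd : (e + f) % 2 = 1)
    (h1 : e * a - f * b = 0) (h2 : e * b + f * a = 0) : a = 0 ∧ b = 0 := by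
  have key : (e * e + f * f) * (a * a + b * b) = 0 := by
    linear_combination (e * a - f * b) * h1 + (e * b + f * a) * h2
  rcases mul_eq_zero.1 key with h | h
  · exfalso
    have h3 : e = 0 := by nlinarith [mul_self_nonneg e, mul_self_nonneg f]
    have h4 : f = 0 := by nlinarith [mul_self_nonneg e, mul_self_nonneg f]
    subst h3 h4; simp at hodd
  · constructor <;> nlinarith [mul_self_nonneg a, mul_self_nonneg b]

theorem lemE (n : ℕ) : ∀ e f a b : ℤ, (e + f) % 2 = 1 →
    BB n (e * a - f * b) (e * b + f * a) → BB n a b := by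
  have gen : ∀ n, ∀ e f a b : ℤ, (e + f) % 2 = 1 → BB n (e * a - f * b) (e * b + f * a) →
      (a % 2 = 1 ∨ b % 2 = 1) → BB n a b := fun n e f a b h1 h2 h3 =>
    oct_BB _ _ _ (octdiv n e f a b h1 (BB_oct _ _ _ h2)) h3
  induction n using two_step with
  | h0 =>
    intro e f a b h1 h2
    have := octdiv 0 e f a b h1 (BB_oct _ _ _ h2)
    simp only [BB, Oct, ww] at *
    omega
  | h1 =>
    intro e f a b h1 h2
    by_cases hp : a % 2 = 1 ∨ b % 2 = 1
    · exact gen _ _ _ _ _ h1 h2 hp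
    obtain ⟨x, rfl⟩ : ∃ k, a = 2 * k := ⟨a / 2, by omega⟩
    obtain ⟨y, rfl⟩ : ∃ k, b = 2 * k := ⟨b / 2, by omega⟩
    have h3 := BB_one_even (e * x - f * y) (e * y + f * x) (by convert h2 using 1 <;> ring)
    have h4 := mul_ne e f x y h1 h3.1 h3.2
    rw [h4.1, h4.2]; exact BB_zero_mem 1
  | h2 n ih =>
    intro e f a b h1 h2
    by_cases hp : a % 2 = 1 ∨ b % 2 = 1
    · exact gen _ _ _ _ _ h1 h2 hp
    obtain ⟨x, rfl⟩ : ∃ k, a = 2 * k := ⟨a / 2, by omega⟩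
    obtain ⟨y, rfl⟩ : ∃ k, b = 2 * k := ⟨b / 2, by omega⟩
    rw [BB_double]
    apply ih e f x y h1
    rw [← BB_double]
    convert h2 using 1 <;> ring

theorem digit_iff (u : GaussianInt) :
    u ∈ ({0, 1, -1, ⟨0, 1⟩, ⟨0, -1⟩} : Set GaussianInt) ↔ |u.re| + |u.im| ≤ 1 := by
  simp only [Set.mem_insert_iff, Set.mem_singleton_iff, Zsqrtd.ext_iff, Zsqrtd.re_zero,
    Zsqrtd.im_zero, Zsqrtd.re_one, Zsqrtd.im_one, Zsqrtd.re_neg, Zsqrtd.im_neg]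
  generalize u.re = a
  generalize u.im = b
  ((try simp only [abs_eq_max_neg] at *); omega)

theorem Bset_iff (n : ℕ) : ∀ z, z ∈ Bset n ↔ BB n z.re z.im := by
  induction n with
  | zero =>
    intro z
    simp only [Bset, BB, Set.mem_setOf_eq]
    rw [← digit_iff]
    constructor
    · rintro ⟨v, h1, h2⟩
      simp at h2
      rw [h2]; exact h1 0
    · intro h
      exact ⟨fun _ => z, fun _ => h, by simp⟩
  | succ n ih =>
    intro z
    constructor
    · rintro ⟨v, h1, h2⟩
      have h3 := (ih _).1 ⟨fun j => v (j + 1), fun j => h1 _, rfl⟩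
      refine ⟨(v 0).re, (v 0).im, _, _, (digit_iff _).1 (h1 0), h3, ?_⟩
      rw [Finset.sum_range_succ'] at h2
      simp only [pow_succ, ← mul_assoc, ← Finset.sum_mul] at h2
      rw [h2]
      simp
      constructor <;> ring
    · rintro ⟨u, v, p, q, h1, h2, h3, h4⟩
      obtain ⟨w, w1, w2⟩ := (ih ⟨p, q⟩).2 h2
      refine ⟨fun j => Nat.casesOn j ⟨u, v⟩ w, ?_, ?_⟩
      · intro j
        cases j with
        | zero => exact (digit_iff _).2 h1
        | succ j => exact w1 j
      · rw [Finset.sum_range_succ']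
        simp only [pow_succ, ← mul_assoc, ← Finset.sum_mul]
        rw [← w2]
        apply Zsqrtd.ext
        · simp [h3]; ring
        · simp [h4]; ring

theorem unit_iff (z : GaussianInt) : (z = 0 ∨ IsUnit z) ↔ |z.re| + |z.im| ≤ 1 := by
  rw [← digit_iff]
  constructor
  · rintro (rfl | h)
    · simp
    · rw [digit_iff]
      rw [← Zsqrtd.norm_eq_one_iff] at h
      have h2 : z.norm = 1 := by
        have := GaussianInt.norm_nonneg z
        omega
      rw [Zsqrtd.norm_def] at h2
      have e1 : z.re ≤ 1 := by nlinarith [mul_self_nonneg z.im]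
      have e2 : -1 ≤ z.re := by nlinarith [mul_self_nonneg z.im]
      have f1 : z.im ≤ 1 := by nlinarith [mul_self_nonneg z.re]
      have f2 : -1 ≤ z.im := by nlinarith [mul_self_nonneg z.re]
      generalize z.re = a at *
      generalize z.im = b at *
      interval_cases a <;> interval_cases b <;> simp at *
  · intro h
    simp only [Set.mem_insert_iff, Set.mem_singleton_iff] at h
    rcases h with rfl | rfl | rfl | rfl | rfl
    · simp
    · simp
    · right; exact isUnit_one.neg
    · right; exact IsUnit.of_mul_eq_one ⟨0, -1⟩ (by decide)
    · right; exact IsUnit.of_mul_eq_one ⟨0, 1⟩ (by decide)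

theorem Motzkin_iff (n : ℕ) : ∀ z, z ∈ MotzkinSet n ↔ BB n z.re z.im := by
  induction n with
  | zero => intro z; exact unit_iff z
  | succ n ih =>
    intro z
    constructor
    · rintro (h | h)
      · exact BB_mono _ _ _ ((ih z).1 h)
      · have hx : ∃ e s t : ℤ, |e| + |(0 : ℤ)| ≤ 1 ∧ z.re = e + (s - t) ∧ z.im = s + t := by
          generalize z.re = x
          generalize z.im = y
          have h4 : (x + y) % 2 = 0 ∨ (x + y) % 2 = 1 := by omega
          rcases h4 with h4 | h4
          · exact ⟨0, (x + y) / 2, (y - x) / 2, by simp, by omega, by omega⟩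
          · exact ⟨1, (x - 1 + y) / 2, (y - x + 1) / 2, by simp, by omega, by omega⟩
        obtain ⟨e, s, t, he, h1, h2⟩ := hx
        obtain ⟨r, hr, q, hq⟩ := h ⟨s, t⟩
        rw [ih] at hr
        have hq1 := congrArg Zsqrtd.re hq
        have hq2 := congrArg Zsqrtd.im hq
        simp at hq1 hq2
        apply lemE (n + 1) (1 - (q.re - q.im)) (-(q.re + q.im)) _ _ (by omega)
        refine ⟨e, 0, r.re, r.im, he, hr, ?_, ?_⟩
        · linear_combination h1 + hq1 - hq2
        · linear_combination h2 + hq1 + hq2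
    · intro h
      by_cases h0 : z.re = 0 ∧ z.im = 0
      · left
        rw [ih, h0.1, h0.2]
        exact BB_zero_mem n
      · right
        intro x
        obtain ⟨c, d, hh⟩ := lemD n _ _ h h0 x.re x.im
        refine ⟨⟨_, _⟩, (ih _).2 hh, ⟨c, d⟩, ?_⟩
        apply Zsqrtd.ext <;> simp <;> ring

theorem lenstra (n : ℕ) :
    MotzkinSet n = Bset n ∧ {z : GaussianInt | phi z ≤ n} = Bset n := by
  have h1 : MotzkinSet n = Bset n := by
    ext z; rw [Motzkin_iff, Bset_iff]
  refine ⟨h1, ?_⟩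
  rw [← h1]
  have mono : Monotone MotzkinSet := monotone_nat_of_le_succ fun n => by
    intro z h; exact Or.inl h
  ext z
  constructor
  · intro h
    have hne : {n | z ∈ MotzkinSet n}.Nonempty := by
      obtain ⟨m, hm⟩ := BB_exists z.re z.im
      exact ⟨m, (Motzkin_iff m z).2 hm⟩
    exact mono h (Nat.sInf_mem hne)
  · intro h
    exact Nat.sInf_le h
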